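/- Let m ∈ ℕ, ε̂ > 0, and let ω = (ω¹, ω²) : ℝ² × ℝ^m → ℝ² be smooth on an open neighborhood of the closed ball B̄ of radius ε̂ centered at the origin of ℝ^{2+m}, with ω(0,0,z) = 0 for every z with (0,0,z) ∈ B̄, and such that the total derivative at the origin of the map (y,z) ↦ (ω(y,z), z) from ℝ^{2+m} to ℝ^{2+m} is invertible. Fix b ∈ ℝ. Then there exist ε* ∈ (0, ε̂], real numbers b' and χ > 0, functions Φ, R : ℝ × ℝ^m → ℝ smooth on an open neighborhood of K_{ε*}, and constants c > 0 and c_{kα} > 0 (for each k ∈ ℕ and multi-index α with k + |α| ≥ 1) such that for all (r,z) ∈ K_{ε*}: (i) ω(r·cos b, r·sin b, z) = ((χr + R(r,z))·cos(b' + Φ(r,z)), (χr + R(r,z))·sin(b' + Φ(r,z))); (ii) |Φ(r,z)| ≤ c·(r² + |z|²)^{1/2} and |R(r,z)| ≤ c·(r² + |z|²)^{1/2}·r; (iii) |∂_r^k ∂_z^α Φ(r,z)| ≤ c_{kα}, and |∂_r^k ∂_z^α (R(r,z)/r)| ≤ c_{kα} whenever r > 0. -/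

import Mathlib

/-- The closed ball of radius `ε` centered at the origin of `ℝ^{2+m}`
(Euclidean norm), with points written `(y₁, y₂, z)`. -/
def Bball (m : ℕ) (ε : ℝ) : Set (ℝ × ℝ × (Fin m → ℝ)) :=
  {p | Real.sqrt (p.1 ^ 2 + p.2.1 ^ 2 + ∑ i, p.2.2 i ^ 2) ≤ ε}

/-- `K_ε = {(r,z) : r ≥ 0, (r² + |z|²)^{1/2} ≤ ε}` with `|z|` the Euclidean norm. -/
def Kset (m : ℕ) (ε : ℝ) : Set (ℝ × (Fin m → ℝ)) :=
  {p | 0 ≤ p.1 ∧ Real.sqrt (p.1 ^ 2 + ∑ i, p.2 i ^ 2) ≤ ε}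

/-- Partial derivative in the radial variable `r` of a function `h(r, z)`. -/
noncomputable def pr {m : ℕ} (h : ℝ × (Fin m → ℝ) → ℝ) : ℝ × (Fin m → ℝ) → ℝ :=
  fun p => deriv (fun t => h (t, p.2)) p.1

/-- Partial derivative in the variable `z i` of a function `h(r, z)`. -/
noncomputable def pzi {m : ℕ} (i : Fin m) (h : ℝ × (Fin m → ℝ) → ℝ) :
    ℝ × (Fin m → ℝ) → ℝ :=
  fun p => deriv (fun t => h (p.1, Function.update p.2 i t)) (p.2 i)

/-- Iterated partial derivatives in the `z` variables according to the
multi-index recorded by the list `αs` of coordinate indices. -/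
noncomputable def pz {m : ℕ} (αs : List (Fin m)) (h : ℝ × (Fin m → ℝ) → ℝ) :
    ℝ × (Fin m → ℝ) → ℝ :=
  αs.foldr pzi h

section PolarForm

open Set Filter Topology MeasureTheory
open scoped ContDiff Convolution

section Partial

variable {m : ℕ} {V : Set (ℝ × (Fin m → ℝ))} {f g : ℝ × (Fin m → ℝ) → ℝ}

theorem pr_eq_fderiv {p : ℝ × (Fin m → ℝ)} (hf : DifferentiableAt ℝ f p) :
    pr f p = fderiv ℝ f p (1, 0) := by
  have h : HasDerivAt (fun t : ℝ => (t, p.2)) ((1 : ℝ), (0 : Fin m → ℝ)) p.1 :=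
    (hasDerivAt_id _).prodMk (hasDerivAt_const _ _)
  exact (HasFDerivAt.comp_hasDerivAt (f := fun t : ℝ => (t, p.2)) p.1 hf.hasFDerivAt h).deriv

theorem pzi_eq_fderiv {p : ℝ × (Fin m → ℝ)} (i : Fin m) (hf : DifferentiableAt ℝ f p) :
    pzi i f p = fderiv ℝ f p (0, Pi.single i 1) := by
  have h : HasDerivAt (fun t : ℝ => (p.1, Function.update p.2 i t))
      ((0 : ℝ), (Pi.single i 1 : Fin m → ℝ)) (p.2 i) :=
    (hasDerivAt_const _ _).prodMk (hasDerivAt_update p.2 i (p.2 i))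
  refine (HasFDerivAt.comp_hasDerivAt (f := fun t : ℝ => (p.1, Function.update p.2 i t))
    (p.2 i) ?_ h).deriv
  simpa using hf.hasFDerivAt

theorem ContDiffOn.pr (hV : IsOpen V) (hf : ContDiffOn ℝ ∞ f V) : ContDiffOn ℝ ∞ (pr f) V := by
  have h := (contDiffOn_infty_iff_fderiv_of_isOpen hV).1 hf
  refine (h.2.clm_apply (contDiffOn_const (c := ((1 : ℝ), (0 : Fin m → ℝ))))).congr fun p hp => ?_
  exact pr_eq_fderiv (h.1.differentiableAt (hV.mem_nhds hp))

theorem ContDiffOn.pzi (hV : IsOpen V) (i : Fin m) (hf : ContDiffOn ℝ ∞ f V) :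
    ContDiffOn ℝ ∞ (pzi i f) V := by
  have h := (contDiffOn_infty_iff_fderiv_of_isOpen hV).1 hf
  refine (h.2.clm_apply (contDiffOn_const
    (c := ((0 : ℝ), (Pi.single i 1 : Fin m → ℝ))))).congr fun p hp => ?_
  exact pzi_eq_fderiv i (h.1.differentiableAt (hV.mem_nhds hp))

theorem ContDiffOn.iterate_pr_pz (hV : IsOpen V) (hf : ContDiffOn ℝ ∞ f V) (k : ℕ)
    (αs : List (Fin m)) : ContDiffOn ℝ ∞ (_root_.pr^[k] (pz αs f)) V := by
  induction k with
  | zero =>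
    induction αs with
    | nil => exact hf
    | cons i αs ih => exact ih.pzi hV i
  | succ k ih =>
    rw [Function.iterate_succ_apply']
    exact ih.pr hV

theorem Set.EqOn.pr (hV : IsOpen V) (h : EqOn f g V) : EqOn (pr f) (pr g) V := by
  intro p hp
  refine Filter.EventuallyEq.deriv_eq ?_
  have hc : ContinuousAt (fun t : ℝ => (t, p.2)) p.1 := by fun_prop
  filter_upwards [hc.preimage_mem_nhds (hV.mem_nhds hp)] with t ht using h ht

theorem Set.EqOn.pzi (hV : IsOpen V) (i : Fin m) (h : EqOn f g V) :
    EqOn (pzi i f) (pzi i g) V := by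
  intro p hp
  refine Filter.EventuallyEq.deriv_eq ?_
  have hc : ContinuousAt (fun t : ℝ => (p.1, Function.update p.2 i t)) (p.2 i) := by fun_prop
  filter_upwards [hc.preimage_mem_nhds (hV.mem_nhds (by simpa using hp))] with t ht using h ht

theorem Set.EqOn.iterate_pr_pz (hV : IsOpen V) (h : EqOn f g V) (k : ℕ) (αs : List (Fin m)) :
    EqOn (_root_.pr^[k] (pz αs f)) (_root_.pr^[k] (pz αs g)) V := by
  induction k with
  | zero =>
    induction αs with
    | nil => exact h
    | cons i αs ih => exact ih.pzi hV i
  | succ k ih =>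
    rw [Function.iterate_succ_apply', Function.iterate_succ_apply']
    exact ih.pr hV

end Partial

section Kset

variable {m : ℕ} {ε : ℝ}

theorem norm_le_sqrt_sq_add_sum_sq (p : ℝ × (Fin m → ℝ)) :
    ‖p‖ ≤ Real.sqrt (p.1 ^ 2 + ∑ i, p.2 i ^ 2) := by
  have hs : 0 ≤ ∑ i, p.2 i ^ 2 := Finset.sum_nonneg fun i _ => sq_nonneg _
  refine max_le ?_ ((pi_norm_le_iff_of_nonneg (Real.sqrt_nonneg _)).2 fun i => ?_)
  · exact Real.abs_le_sqrt (by linarith)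
  · refine Real.abs_le_sqrt ?_
    have := Finset.single_le_sum (f := fun i => p.2 i ^ 2) (fun i _ => sq_nonneg _)
      (Finset.mem_univ i)
    nlinarith [sq_nonneg p.1]

theorem Kset_subset_closedBall : Kset m ε ⊆ Metric.closedBall 0 ε := fun p hp => by
  simpa using (norm_le_sqrt_sq_add_sum_sq p).trans hp.2

theorem isCompact_Kset : IsCompact (Kset m ε) := by
  refine (isCompact_closedBall 0 ε).of_isClosed_subset ?_ Kset_subset_closedBall
  have h₁ : IsClosed {p : ℝ × (Fin m → ℝ) | 0 ≤ p.1} := isClosed_le (by fun_prop) (by fun_prop)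
  have h₂ : IsClosed {p : ℝ × (Fin m → ℝ) | Real.sqrt (p.1 ^ 2 + ∑ i, p.2 i ^ 2) ≤ ε} :=
    isClosed_le (by fun_prop) (by fun_prop)
  exact h₁.inter h₂

end Kset

/-- **Hadamard's lemma** in the first variable. -/
theorem ContDiff.exists_eq_add_mul {E : Type*} [NormedAddCommGroup E] [NormedSpace ℝ E]
    {f : ℝ × E → ℝ} (hf : ContDiff ℝ ∞ f) :
    ∃ g : ℝ × E → ℝ, ContDiff ℝ ∞ g ∧ ∀ p, f p = f (0, p.2) + p.1 * g p := by
  let d : ℝ × E → ℝ := fun p => fderiv ℝ f p (1, 0)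
  have hd : ContDiff ℝ ∞ d :=
    (contDiff_infty_iff_fderiv.1 hf).2.clm_apply contDiff_const
  let φ : ContDiffBump (0 : ℝ) := ⟨2, 3, by norm_num, by norm_num⟩
  let h : ℝ × E → ℝ → ℝ := fun p s => φ s * d (-s * p.1, p.2)
  have hh : ContDiff ℝ ∞ ↿h := by
    have : ContDiff ℝ ∞ (fun q : (ℝ × E) × ℝ => d (-q.2 * q.1.1, q.1.2)) :=
      hd.comp (by fun_prop)
    exact (φ.contDiff.comp contDiff_snd).mul this
  let e : ℝ → ℝ := indicator (Ioc 0 1) 1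
  have he : LocallyIntegrable e := by
    refine Integrable.locallyIntegrable ?_
    exact (integrable_indicator_iff measurableSet_Ioc).2 (integrableOn_const (by simp))
  refine ⟨fun p => ∫ s in (0 : ℝ)..1, d (s * p.1, p.2), ?_, fun p => ?_⟩
  · have hconv := contDiffOn_convolution_right_with_param_comp (n := ⊤) (μ := volume)
      (ContinuousLinearMap.mul ℝ ℝ) (s := univ) (v := fun _ : ℝ × E => (0 : ℝ))
      contDiffOn_const (f := e) (g := h) isOpen_univ (isCompact_closedBall (0 : ℝ) 3)
      (fun p x _ hx => by
        have : φ x = 0 := φ.zero_of_le_dist (by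
          rw [Metric.mem_closedBall, not_le] at hx
          exact hx.le)
        simp [h, this]) he hh.contDiffOn
    refine contDiffOn_univ.1 (hconv.congr fun p _ => ?_)
    rw [intervalIntegral.integral_of_le zero_le_one, ← integral_indicator measurableSet_Ioc]
    refine integral_congr_ae (ae_of_all _ fun s => ?_)
    by_cases hs : s ∈ Ioc (0 : ℝ) 1
    · have : φ (-s) = 1 := φ.one_of_mem_closedBall (by
        simp only [mem_closedBall_zero_iff, norm_neg, Real.norm_eq_abs, abs_of_pos hs.1]
        exact hs.2.trans one_le_two)
      simp [e, h, hs, this]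
    · simp [e, hs]
  · have hder : ∀ s : ℝ, HasDerivAt (fun s : ℝ => f (s * p.1, p.2)) (p.1 * d (s * p.1, p.2)) s := by
      intro s
      have h1 : HasDerivAt (fun s : ℝ => (s * p.1, p.2)) (p.1, (0 : E)) s := by
        simpa using ((hasDerivAt_id s).mul_const p.1).prodMk (hasDerivAt_const s p.2)
      have h2 := HasFDerivAt.comp_hasDerivAt s
        ((hf.differentiable (by simp)) (s * p.1, p.2)).hasFDerivAt h1
      have h3 : (p.1, (0 : E)) = p.1 • ((1 : ℝ), (0 : E)) := by simp
      rw [h3, map_smul] at h2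
      exact h2
    have hint := intervalIntegral.integral_eq_sub_of_hasDerivAt (a := 0) (b := 1)
      (fun s _ => hder s) (Continuous.intervalIntegrable (by
        have := hd.continuous
        fun_prop) _ _)
    rw [intervalIntegral.integral_const_mul] at hint
    simp only [one_mul, zero_mul] at hint
    rw [hint]
    ring

/-- A function smooth on a ball agrees with a globally smooth one on a concentric smaller ball. -/
theorem ContDiffOn.exists_contDiff_eqOn_closedBall {E : Type*} [NormedAddCommGroup E]
    [NormedSpace ℝ E] [FiniteDimensional ℝ E] {f : E → ℝ} {x : E} {δ : ℝ} (hδ : 0 < δ)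
    (hf : ContDiffOn ℝ ∞ f (Metric.ball x δ)) :
    ∃ g : E → ℝ, ContDiff ℝ ∞ g ∧ EqOn f g (Metric.closedBall x (δ / 3)) := by
  let φ : ContDiffBump x := ⟨δ / 3, δ / 2, by positivity, by linarith⟩
  refine ⟨fun y => φ y * f y, contDiff_iff_contDiffAt.2 fun y => ?_, fun y hy => ?_⟩
  · by_cases hy : y ∈ Metric.ball x δ
    · exact φ.contDiff.contDiffAt.mul (hf.contDiffAt (Metric.isOpen_ball.mem_nhds hy))
    · have hy' : y ∈ (tsupport φ)ᶜ := by
        rw [φ.tsupport_eq, mem_compl_iff, Metric.mem_closedBall]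
        rw [Metric.mem_ball] at hy
        exact fun h => hy (h.trans_lt (half_lt_self hδ))
      refine (contDiffAt_const (c := (0 : ℝ))).congr_of_eventuallyEq ?_
      filter_upwards [(isClosed_tsupport φ).isOpen_compl.mem_nhds hy'] with w hw
      simp [image_eq_zero_of_notMem_tsupport hw]
  · simp [φ.one_of_mem_closedBall hy]

theorem ContDiffAt.exists_abs_le_mul_norm {E : Type*} [NormedAddCommGroup E] [NormedSpace ℝ E]
    {f : E → ℝ} (hf : ContDiffAt ℝ 1 f 0) (h0 : f 0 = 0) :
    ∃ c > 0, ∀ᶠ x in 𝓝 0, |f x| ≤ c * ‖x‖ := by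
  obtain ⟨K, t, ht, hK⟩ := hf.exists_lipschitzOnWith
  refine ⟨K + 1, by positivity, ?_⟩
  filter_upwards [ht] with x hx
  have := hK.dist_le_mul x hx 0 (mem_of_mem_nhds ht)
  rw [h0, dist_zero_right, dist_zero_right, Real.norm_eq_abs] at this
  nlinarith [norm_nonneg x]

theorem sqrt_mul_cos_sin_arctan {x y : ℝ} (hx : 0 < x) :
    Real.sqrt (x ^ 2 + y ^ 2) * Real.cos (Real.arctan (y / x)) = x ∧
    Real.sqrt (x ^ 2 + y ^ 2) * Real.sin (Real.arctan (y / x)) = y := by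
  have hs : Real.sqrt (x ^ 2 + y ^ 2) = x * Real.sqrt (1 + (y / x) ^ 2) := by
    rw [← Real.sqrt_sq hx.le, ← Real.sqrt_mul (sq_nonneg _), Real.sqrt_sq hx.le]
    congr 1
    field_simp
  have hpos : 0 < Real.sqrt (1 + (y / x) ^ 2) := Real.sqrt_pos.2 (by positivity)
  rw [hs, Real.cos_arctan, Real.sin_arctan]
  constructor <;> field_simp

theorem exists_bound_iterate_pr_pz {m : ℕ} {ε : ℝ} {V : Set (ℝ × (Fin m → ℝ))} (hV : IsOpen V)
    (hK : Kset m ε ⊆ V) {f : ℝ × (Fin m → ℝ) → ℝ} (hf : ContDiffOn ℝ ∞ f V) (k : ℕ)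
    (αs : List (Fin m)) : ∃ C, ∀ p ∈ Kset m ε, |pr^[k] (pz αs f) p| ≤ C :=
  isCompact_Kset.exists_bound_of_continuousOn ((hf.iterate_pr_pz hV k αs).continuousOn.mono hK)

/-- Restricted to the half-line of angle `b`, a function vanishing on the axis `y = 0` is `r` times a
smooth function whose value at the origin is the directional derivative. -/
theorem exists_radial_factor {m : ℕ} {εhat : ℝ} (hε : 0 < εhat) {η : ℝ × ℝ × (Fin m → ℝ) → ℝ}
    {U : Set (ℝ × ℝ × (Fin m → ℝ))} (hU : IsOpen U) (hBU : Bball m εhat ⊆ U)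
    (hη : ContDiffOn ℝ ∞ η U)
    (hvanish : ∀ z : Fin m → ℝ, ((0 : ℝ), (0 : ℝ), z) ∈ Bball m εhat → η (0, 0, z) = 0) (b : ℝ) :
    ∃ ε > 0, ε ≤ εhat ∧ ∃ G : ℝ × (Fin m → ℝ) → ℝ, ContDiff ℝ ∞ G ∧
      (∀ p ∈ Kset m ε, η (p.1 * Real.cos b, p.1 * Real.sin b, p.2) = p.1 * G p) ∧
      G 0 = fderiv ℝ η 0 (Real.cos b, Real.sin b, 0) := by
  let l : ℝ × (Fin m → ℝ) → ℝ × ℝ × (Fin m → ℝ) :=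
    fun p => (p.1 * Real.cos b, p.1 * Real.sin b, p.2)
  have hl : ContDiff ℝ ∞ l := by fun_prop
  have hl0 : l 0 = 0 := by simp [l]
  have h0U : (0 : ℝ × ℝ × (Fin m → ℝ)) ∈ U := hBU (by simp [Bball, hε.le])
  obtain ⟨δ, hδ, hball⟩ := Metric.isOpen_iff.1 (hU.preimage hl.continuous) 0
    (by rwa [mem_preimage, hl0])
  obtain ⟨f, hf, hfeq⟩ := (hη.comp hl.contDiffOn hball).exists_contDiff_eqOn_closedBall hδ
  obtain ⟨G, hG, hfG⟩ := hf.exists_eq_add_mul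
  have hδ3 : 0 < δ / 3 := by positivity
  have hK : ∀ p ∈ Kset m (min εhat (δ / 3)), p ∈ Metric.closedBall 0 (δ / 3) := fun p hp =>
    Metric.closedBall_subset_closedBall (min_le_right _ _) (Kset_subset_closedBall hp)
  refine ⟨min εhat (δ / 3), lt_min hε hδ3, min_le_left _ _, G, hG, fun p hp => ?_, ?_⟩
  · have hp0 : ((0 : ℝ), p.2) ∈ Kset m (min εhat (δ / 3)) := by
      refine ⟨le_rfl, (Real.sqrt_le_sqrt ?_).trans hp.2⟩
      simpa using sq_nonneg p.1
    have hz : η (0, 0, p.2) = 0 := hvanish _ (by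
      simpa [Bball] using hp0.2.trans (min_le_left _ _))
    have h1 : f (0, p.2) = 0 := by
      rw [← hfeq (hK _ hp0)]
      simpa [l] using hz
    have h2 := hfG p
    rwa [h1, zero_add, ← hfeq (hK p hp)] at h2
  · have h1 : HasDerivAt (fun r : ℝ => f (r, 0)) (G 0) 0 := by
      have hG' : DifferentiableAt ℝ (fun r : ℝ => G (r, 0)) 0 := by
        have := hG.differentiable (by simp)
        fun_prop
      have h := ((hasDerivAt_id (0 : ℝ)).mul hG'.hasDerivAt).const_add (f (0, 0))
      refine (h.congr_deriv (by simp; rfl)).congr_of_eventuallyEq (.of_forall fun r => ?_)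
      exact hfG (r, 0)
    have h2 : HasDerivAt (fun r : ℝ => f (r, 0))
        (fderiv ℝ η 0 (Real.cos b, Real.sin b, 0)) 0 := by
      have hη0 : HasFDerivAt η (fderiv ℝ η 0) (l (0, 0)) := by
        have h : DifferentiableAt ℝ η 0 :=
          (hη.contDiffAt (hU.mem_nhds h0U)).differentiableAt (by simp)
        exact hl0.symm ▸ h.hasFDerivAt
      have hlr : HasDerivAt (fun r : ℝ => l (r, 0))
          (Real.cos b, Real.sin b, (0 : Fin m → ℝ)) 0 := by
        have := (hasDerivAt_mul_const (x := (0 : ℝ)) (Real.cos b)).prodMk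
          ((hasDerivAt_mul_const (x := (0 : ℝ)) (Real.sin b)).prodMk
            (hasDerivAt_const (0 : ℝ) (0 : Fin m → ℝ)))
        exact this
      refine (HasFDerivAt.comp_hasDerivAt (0 : ℝ) hη0 hlr).congr_of_eventuallyEq ?_
      have hc : ContinuousAt (fun r : ℝ => (r, (0 : Fin m → ℝ))) 0 := by fun_prop
      filter_upwards [hc.preimage_mem_nhds (Metric.closedBall_mem_nhds _ hδ3)] with r hr
      exact (hfeq hr).symm
    exact h1.unique h2

/-- Polar representation of `r * (G₁, G₂)` for smooth `G₁, G₂` not both vanishing at the origin. -/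
theorem exists_polar_representation {m : ℕ} {G₁ G₂ : ℝ × (Fin m → ℝ) → ℝ}
    (hG₁ : ContDiff ℝ ∞ G₁) (hG₂ : ContDiff ℝ ∞ G₂) (hne : ¬(G₁ 0 = 0 ∧ G₂ 0 = 0)) :
    ∃ b' χ : ℝ, 0 < χ ∧ ∃ Φ S : ℝ × (Fin m → ℝ) → ℝ, ∃ δ > 0,
      ContDiffOn ℝ ∞ Φ (Metric.ball 0 δ) ∧ ContDiffOn ℝ ∞ S (Metric.ball 0 δ) ∧
      (∀ p ∈ Metric.ball 0 δ, G₁ p = (χ + S p) * Real.cos (b' + Φ p) ∧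
        G₂ p = (χ + S p) * Real.sin (b' + Φ p)) ∧
      ∃ c > 0, ∀ p ∈ Metric.ball 0 δ, |Φ p| ≤ c * ‖p‖ ∧ |S p| ≤ c * ‖p‖ := by
  let w : ℂ := ⟨G₁ 0, G₂ 0⟩
  have hw : 0 < ‖w‖ := norm_pos_iff.2 fun h => hne ⟨congrArg Complex.re h, congrArg Complex.im h⟩
  have hw₁ : G₁ 0 = ‖w‖ * Real.cos w.arg := (Complex.norm_mul_cos_arg w).symm
  have hw₂ : G₂ 0 = ‖w‖ * Real.sin w.arg := (Complex.norm_mul_sin_arg w).symm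
  have htrig := Real.sin_sq_add_cos_sq w.arg
  let A : ℝ × (Fin m → ℝ) → ℝ := fun p => G₁ p * Real.cos w.arg + G₂ p * Real.sin w.arg
  let B : ℝ × (Fin m → ℝ) → ℝ := fun p => G₂ p * Real.cos w.arg - G₁ p * Real.sin w.arg
  have hA : ContDiff ℝ ∞ A := by fun_prop
  have hB : ContDiff ℝ ∞ B := by fun_prop
  have hA0 : A 0 = ‖w‖ := by
    simp only [A, hw₁, hw₂]
    linear_combination ‖w‖ * htrig
  have hB0 : B 0 = 0 := by
    simp only [B, hw₁, hw₂]
    ring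
  let Φ : ℝ × (Fin m → ℝ) → ℝ := fun p => Real.arctan (B p / A p)
  let S : ℝ × (Fin m → ℝ) → ℝ := fun p => Real.sqrt (A p ^ 2 + B p ^ 2) - ‖w‖
  have hΦ : ∀ p, 0 < A p → ContDiffAt ℝ ∞ Φ p := fun p hp =>
    (hB.contDiffAt.div hA.contDiffAt hp.ne').arctan
  have hS : ∀ p, 0 < A p → ContDiffAt ℝ ∞ S p := fun p hp =>
    (((hA.contDiffAt.pow 2).add (hB.contDiffAt.pow 2)).sqrt (by positivity)).sub contDiffAt_const
  have hApos : ∀ᶠ p in 𝓝 0, 0 < A p :=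
    hA.continuous.continuousAt.eventually_mem (Ioi_mem_nhds (hA0.symm ▸ hw))
  obtain ⟨c, hc, hΦc⟩ := ((hΦ 0 (hA0.symm ▸ hw)).of_le (by simp)).exists_abs_le_mul_norm
    (by simp [Φ, hB0])
  obtain ⟨c', hc', hSc⟩ := ((hS 0 (hA0.symm ▸ hw)).of_le (by simp)).exists_abs_le_mul_norm
    (by simp [S, hB0, hA0])
  obtain ⟨δ, hδ, hball⟩ := Metric.eventually_nhds_iff_ball.1 (hApos.and (hΦc.and hSc))
  refine ⟨w.arg, ‖w‖, hw, Φ, S, δ, hδ, fun p hp => (hΦ p (hball p hp).1).contDiffWithinAt,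
    fun p hp => (hS p (hball p hp).1).contDiffWithinAt, fun p hp => ?_, max c c',
    lt_max_of_lt_left hc, fun p hp => ⟨?_, ?_⟩⟩
  · obtain ⟨hcos, hsin⟩ := sqrt_mul_cos_sin_arctan (y := B p) (hball p hp).1
    simp only [S, Φ, add_sub_cancel, Real.cos_add, Real.sin_add]
    constructor
    · calc G₁ p = A p * Real.cos w.arg - B p * Real.sin w.arg := by
            simp only [A, B]
            linear_combination -G₁ p * htrig
        _ = _ := by linear_combination -Real.cos w.arg * hcos + Real.sin w.arg * hsin
    · calc G₂ p = A p * Real.sin w.arg + B p * Real.cos w.arg := by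
            simp only [A, B]
            linear_combination -G₂ p * htrig
        _ = _ := by linear_combination -Real.sin w.arg * hcos - Real.cos w.arg * hsin
  · exact (hball p hp).2.1.trans (by gcongr; exact le_max_left _ _)
  · exact (hball p hp).2.2.trans (by gcongr; exact le_max_right _ _)

end PolarForm

theorem stmt7 (m : ℕ) (εhat : ℝ) (hε : 0 < εhat)
    (ω₁ ω₂ : ℝ × ℝ × (Fin m → ℝ) → ℝ)
    (U : Set (ℝ × ℝ × (Fin m → ℝ))) (hU : IsOpen U) (hBU : Bball m εhat ⊆ U)
    (hsmooth₁ : ContDiffOn ℝ (⊤ : ℕ∞) ω₁ U) (hsmooth₂ : ContDiffOn ℝ (⊤ : ℕ∞) ω₂ U)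
    (hvanish : ∀ z : Fin m → ℝ, ((0 : ℝ), (0 : ℝ), z) ∈ Bball m εhat →
      ω₁ (0, 0, z) = 0 ∧ ω₂ (0, 0, z) = 0)
    -- the total derivative at the origin of `(y, z) ↦ (ω(y, z), z)` is invertible
    (hinv : Function.Bijective
      (fderiv ℝ (fun p : ℝ × ℝ × (Fin m → ℝ) => (ω₁ p, ω₂ p, p.2.2)) 0))
    (b : ℝ) :
    ∃ εstar : ℝ, 0 < εstar ∧ εstar ≤ εhat ∧
    ∃ b' χ : ℝ, 0 < χ ∧
    ∃ Φ R : ℝ × (Fin m → ℝ) → ℝ,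
    ∃ V : Set (ℝ × (Fin m → ℝ)), IsOpen V ∧ Kset m εstar ⊆ V ∧
      ContDiffOn ℝ (⊤ : ℕ∞) Φ V ∧ ContDiffOn ℝ (⊤ : ℕ∞) R V ∧
      -- (i) the representation of `ω` in polar coordinates
      (∀ p ∈ Kset m εstar,
        ω₁ (p.1 * Real.cos b, p.1 * Real.sin b, p.2) =
          (χ * p.1 + R p) * Real.cos (b' + Φ p) ∧
        ω₂ (p.1 * Real.cos b, p.1 * Real.sin b, p.2) =
          (χ * p.1 + R p) * Real.sin (b' + Φ p)) ∧
      -- (ii) smallness of `Φ` and `R`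
      (∃ c > (0 : ℝ), ∀ p ∈ Kset m εstar,
        |Φ p| ≤ c * Real.sqrt (p.1 ^ 2 + ∑ i, p.2 i ^ 2) ∧
        |R p| ≤ c * Real.sqrt (p.1 ^ 2 + ∑ i, p.2 i ^ 2) * p.1) ∧
      -- (iii) boundedness of the derivatives of `Φ` and of `R/r`
      (∀ (k : ℕ) (αs : List (Fin m)), 1 ≤ k + αs.length →
        ∃ ckα > (0 : ℝ), ∀ p ∈ Kset m εstar,
          |(pr)^[k] (pz αs Φ) p| ≤ ckα ∧
          (0 < p.1 → |(pr)^[k] (pz αs (fun q => R q / q.1)) p| ≤ ckα)) := by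
  obtain ⟨ε₁, hε₁, hle₁, G₁, hG₁, hω₁, hG₁0⟩ := exists_radial_factor hε hU hBU hsmooth₁
    (fun z hz => (hvanish z hz).1) b
  obtain ⟨ε₂, hε₂, -, G₂, hG₂, hω₂, hG₂0⟩ := exists_radial_factor hε hU hBU hsmooth₂
    (fun z hz => (hvanish z hz).2) b
  have hne : ¬(G₁ 0 = 0 ∧ G₂ 0 = 0) := by
    rintro ⟨h₁, h₂⟩
    have h0U : (0 : ℝ × ℝ × (Fin m → ℝ)) ∈ U := hBU (by simp [Bball, hε.le])
    have hd₁ : DifferentiableAt ℝ ω₁ 0 :=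
      (hsmooth₁.contDiffAt (hU.mem_nhds h0U)).differentiableAt (by simp)
    have hd₂ : DifferentiableAt ℝ ω₂ 0 :=
      (hsmooth₂.contDiffAt (hU.mem_nhds h0U)).differentiableAt (by simp)
    have hz : HasFDerivAt (fun p : ℝ × ℝ × (Fin m → ℝ) => p.2.2)
        ((ContinuousLinearMap.snd ℝ ℝ (Fin m → ℝ)).comp (ContinuousLinearMap.snd ℝ ℝ _)) 0 :=
      hasFDerivAt_snd.comp 0 hasFDerivAt_snd
    have hd := (hd₁.hasFDerivAt.prodMk (hd₂.hasFDerivAt.prodMk hz)).fderiv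
    have hv : (Real.cos b, Real.sin b, (0 : Fin m → ℝ)) = 0 := by
      refine hinv.1 ?_
      rw [map_zero, hd]
      simp [← hG₁0, ← hG₂0, h₁, h₂]
    simp only [Prod.mk_eq_zero] at hv
    simpa [hv.1, hv.2.1] using Real.sin_sq_add_cos_sq b
  obtain ⟨b', χ, hχ, Φ, S, δ, hδ, hΦ, hS, hrep, c, hc, hbd⟩ :=
    exists_polar_representation hG₁ hG₂ hne
  have hεδ : min (min ε₁ ε₂) (δ / 2) < δ := (min_le_right _ _).trans_lt (half_lt_self hδ)
  have hK : Kset m (min (min ε₁ ε₂) (δ / 2)) ⊆ Metric.ball 0 δ :=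
    Kset_subset_closedBall.trans (Metric.closedBall_subset_ball hεδ)
  refine ⟨min (min ε₁ ε₂) (δ / 2), lt_min (lt_min hε₁ hε₂) (half_pos hδ),
    ((min_le_left _ _).trans (min_le_left _ _)).trans hle₁, b', χ, hχ, Φ, fun p => p.1 * S p,
    Metric.ball 0 δ, Metric.isOpen_ball, hK, hΦ, contDiffOn_fst.mul hS, fun p hp => ?_,
    ⟨c, hc, fun p hp => ?_⟩, fun k αs _ => ?_⟩
  · have hle := hp.2.trans (min_le_left _ _)
    rw [hω₁ p ⟨hp.1, hle.trans (min_le_left _ _)⟩, hω₂ p ⟨hp.1, hle.trans (min_le_right _ _)⟩]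
    obtain ⟨h₁, h₂⟩ := hrep p (hK hp)
    constructor
    · linear_combination p.1 * h₁
    · linear_combination p.1 * h₂
  · obtain ⟨h₁, h₂⟩ := hbd p (hK hp)
    have hn : c * ‖p‖ ≤ c * Real.sqrt (p.1 ^ 2 + ∑ i, p.2 i ^ 2) :=
      mul_le_mul_of_nonneg_left (norm_le_sqrt_sq_add_sum_sq p) hc.le
    refine ⟨h₁.trans hn, ?_⟩
    rw [abs_mul, abs_of_nonneg hp.1, mul_comm]
    exact mul_le_mul_of_nonneg_right (h₂.trans hn) hp.1
  · obtain ⟨C, hC⟩ := exists_bound_iterate_pr_pz Metric.isOpen_ball hK hΦ k αs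
    obtain ⟨D, hD⟩ := exists_bound_iterate_pr_pz Metric.isOpen_ball hK hS k αs
    refine ⟨max 1 (max C D), by positivity, fun p hp => ⟨(hC p hp).trans (by simp), fun hpos => ?_⟩⟩
    have hopen : IsOpen {q : ℝ × (Fin m → ℝ) | 0 < q.1} := isOpen_lt continuous_const continuous_fst
    have heq : Set.EqOn (fun q => q.1 * S q / q.1) S {q : ℝ × (Fin m → ℝ) | 0 < q.1} :=
      fun q hq => mul_div_cancel_left₀ _ (ne_of_gt hq)
    rw [heq.iterate_pr_pz hopen k αs hpos]
    exact (hD p hp).trans (by simp)
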